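/- arXiv:2105.10028 — 9 statements merged into one kernel-verified Lean document; each statement's English description precedes it below -/
import Mathlib

section
/- Let A, B, S, T, S', T' be types. The optic composition sending ⟦M, u, v⟧ : Optic A B S T and ⟦N, u', v'⟧ : Optic S T S' T' to ⟦N × M, fun s' => let (n, s) := u' s'; let (m, a) := u s; ((n, m), a), fun q => v' (q.1.1, v (q.1.2, q.2))⟧ : Optic A B S' T' is well-defined: replacing either representative by a ∼-equivalent one yields the same equivalence class. -/
/-- A representative of an optic: a residual type `M` with forward and backward parts. -/
def OpticRep (A B S T : Type) : Type 1 :=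
  Σ M : Type, (S → M × A) × (M × B → T)

/-- The generating relation for the optic quotient: sliding a map `f : M → N`
between the residuals of the two legs. -/
inductive OpticRel (A B S T : Type) : OpticRep A B S T → OpticRep A B S T → Prop
  | slide {M N : Type} (f : M → N) (u : S → M × A) (v : N × B → T) :
      OpticRel A B S T ⟨M, u, fun p => v (f p.1, p.2)⟩
        ⟨N, fun s => (f (u s).1, (u s).2), v⟩

/-- `∼` : the equivalence relation generated by the generating relation. -/
def opticSim {A B S T : Type} : OpticRep A B S T → OpticRep A B S T → Prop :=
  Relation.EqvGen (OpticRel A B S T)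

/-- The set (type) of optics: representatives modulo `∼`. -/
def Optic (A B S T : Type) : Type 1 :=
  Quot (OpticRel A B S T)

/-- The class `⟦M, u, v⟧` of a representative. -/
def Optic.mk {A B S T : Type} (x : OpticRep A B S T) : Optic A B S T :=
  Quot.mk (OpticRel A B S T) x

/-- Composition of optic representatives. -/
def compRep {A B S T S' T' : Type}
    (p : OpticRep A B S T) (q : OpticRep S T S' T') : OpticRep A B S' T' :=
  ⟨q.1 × p.1,
   fun s' => (((q.2.1 s').1, (p.2.1 (q.2.1 s').2).1), (p.2.1 (q.2.1 s').2).2),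
   fun r => q.2.2 (r.1.1, p.2.2 (r.1.2, r.2))⟩

theorem OpticRel.compRep_right {A B S T S' T' : Type} {p p' : OpticRep A B S T}
    (h : OpticRel A B S T p p') (q : OpticRep S T S' T') :
    OpticRel A B S' T' (compRep p q) (compRep p' q) := by
  cases h with
  | slide f u v =>
    exact .slide (fun x : q.1 × _ => (x.1, f x.2))
      (fun s' => (((q.2.1 s').1, (u (q.2.1 s').2).1), (u (q.2.1 s').2).2))
      (fun r => q.2.2 (r.1.1, v (r.1.2, r.2)))

theorem OpticRel.compRep_left {A B S T S' T' : Type} {q q' : OpticRep S T S' T'}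
    (p : OpticRep A B S T) (h : OpticRel S T S' T' q q') :
    OpticRel A B S' T' (compRep p q) (compRep p q') := by
  cases h with
  | slide f u v =>
    exact .slide (fun x : _ × p.1 => (f x.1, x.2))
      (fun s' => (((u s').1, (p.2.1 (u s').2).1), (p.2.1 (u s').2).2))
      (fun r => v (r.1.1, p.2.2 (r.1.2, r.2)))

/-- optic composition is well defined on `∼`-equivalence classes. -/
theorem statement1 (A B S T S' T' : Type)
    (p p' : OpticRep A B S T) (q q' : OpticRep S T S' T')
    (hp : opticSim p p') (hq : opticSim q q') :
    Optic.mk (compRep p q) = Optic.mk (compRep p' q') := by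
  have hp' : Optic.mk p = Optic.mk p' := Quot.eqvGen_sound hp
  have hq' : Optic.mk q = Optic.mk q' := Quot.eqvGen_sound hq
  exact congrArg₂ (Quot.map₂ compRep (fun p _ _ h => h.compRep_left p)
    (fun _ _ q h => h.compRep_right q)) hp' hq'
end

section
/- Optic composition is associative: for optics p : Optic A B S T, q : Optic S T S' T', r : Optic S' T' S'' T'', composing p with q and then the result with r gives the same element of Optic A B S'' T'' as composing p with the composite of q and r (where composition of ⟦M, u, v⟧ with ⟦N, u', v'⟧ is ⟦N × M, fun s' => let (n, s) := u' s'; let (m, a) := u s; ((n, m), a), fun q => v' (q.1.1, v (q.1.2, q.2))⟧). -/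
/-- optic composition is associative. -/
theorem statement2 (A B S T S' T' S'' T'' : Type)
    (p : OpticRep A B S T) (q : OpticRep S T S' T') (r : OpticRep S' T' S'' T'') :
    Optic.mk (compRep (compRep p q) r) = Optic.mk (compRep p (compRep q r)) := by
  exact Quot.sound (OpticRel.slide (Equiv.prodAssoc r.1 q.1 p.1).symm
    (compRep (compRep p q) r).2.1 (compRep p (compRep q r)).2.2)
end

section
/- The identity optic 1 := ⟦Unit, fun a => ((), a), fun p => p.2⟧ : Optic A B A B is a two-sided unit for optic composition: for every optic p : Optic A B S T, composing 1 (on the inner side) with p gives p, and composing p with the identity optic of the pair (S, T) (on the outer side) gives p (where composition of ⟦M, u, v⟧ : Optic A B S T with ⟦N, u', v'⟧ : Optic S T S' T' is ⟦N × M, fun s' => let (n, s) := u' s'; let (m, a) := u s; ((n, m), a), fun q => v' (q.1.1, v (q.1.2, q.2))⟧). -/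
/-- The identity optic representative. -/
def idRep (A B : Type) : OpticRep A B A B :=
  ⟨Unit, fun a => ((), a), fun p => p.2⟩

/-- the identity optic is a two-sided unit for optic composition. -/
theorem statement3 (A B S T : Type) (p : OpticRep A B S T) :
    Optic.mk (compRep (idRep A B) p) = Optic.mk p ∧
    Optic.mk (compRep p (idRep S T)) = Optic.mk p := by
  obtain ⟨M, u, v⟩ := p
  exact ⟨Quot.sound (OpticRel.slide (Prod.fst : M × Unit → M) (fun s => (((u s).1, ()), (u s).2)) v),
    Quot.sound (OpticRel.slide (Prod.snd : Unit × M → M) (fun s => (((), (u s).1), (u s).2)) v)⟩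
end

section
/- The escrow composition ◇ : ⟨⟨U,T⟩⟩ × ⟨⟨T,S⟩⟩ → ⟨⟨U,S⟩⟩ sending k = ⟦N, k₁, k₂⟧ and h = ⟦M, h₁, h₂⟧ to k ◇ h := ⟦N × M, fun u => let (n, t) := k₁ u; let (m, s) := h₁ t; ((n, m), s), fun q => h₂ (q.1.2, k₂ (q.1.1, q.2))⟧ is well-defined: replacing either representative by a ∼-equivalent one yields the same equivalence class. -/
/-- Escrow representatives: representatives of `⟨⟨T,S⟩⟩ := Optic S T T S`,
i.e. triples `⟨M, h₁ : T → M × S, h₂ : M × T → S⟩`. -/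
abbrev EscrowRep (T S : Type) : Type 1 := OpticRep S T T S

/-- The set of escrows `⟨⟨T,S⟩⟩ := Optic S T T S`. -/
abbrev Escrow (T S : Type) : Type 1 := Optic S T T S

/-- The escrow composition `◇ : ⟨⟨U,T⟩⟩ × ⟨⟨T,S⟩⟩ → ⟨⟨U,S⟩⟩` on representatives. -/
def diamondRep {U T S : Type} (k : EscrowRep U T) (h : EscrowRep T S) : EscrowRep U S :=
  ⟨k.1 × h.1,
   fun u => (((k.2.1 u).1, (h.2.1 (k.2.1 u).2).1), (h.2.1 (k.2.1 u).2).2),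
   fun q => h.2.2 (q.1.2, k.2.2 (q.1.1, q.2))⟩

/-- Sliding a map in the first factor induces a slide of the composite escrow. -/
theorem OpticRel.diamondRep_left {U T S : Type} {k k' : EscrowRep U T}
    (hk : OpticRel T U U T k k') (h : EscrowRep T S) :
    OpticRel S U U S (diamondRep k h) (diamondRep k' h) := by
  obtain ⟨f, u, v⟩ := hk
  exact OpticRel.slide (Prod.map f id)
    (fun x => (((u x).1, (h.2.1 (u x).2).1), (h.2.1 (u x).2).2))
    (fun q => h.2.2 (q.1.2, v (q.1.1, q.2)))

/-- Sliding a map in the second factor induces a slide of the composite escrow. -/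
theorem OpticRel.diamondRep_right {U T S : Type} (k : EscrowRep U T) {h h' : EscrowRep T S}
    (hh : OpticRel S T T S h h') :
    OpticRel S U U S (diamondRep k h) (diamondRep k h') := by
  obtain ⟨f, u, v⟩ := hh
  exact OpticRel.slide (Prod.map id f)
    (fun x => (((k.2.1 x).1, (u (k.2.1 x).2).1), (u (k.2.1 x).2).2))
    (fun q => v (q.1.2, k.2.2 (q.1.1, q.2)))

/-- the escrow composition `◇` is well defined on `∼`-classes. -/
theorem statement4 (U T S : Type)
    (k k' : EscrowRep U T) (h h' : EscrowRep T S)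
    (hk : opticSim k k') (hh : opticSim h h') :
    Optic.mk (diamondRep k h) = Optic.mk (diamondRep k' h') := by
  have left : Optic.mk (diamondRep k h) = Optic.mk (diamondRep k' h) := by
    induction hk with
    | rel _ _ r => exact Quot.sound (r.diamondRep_left h)
    | refl _ => rfl
    | symm _ _ _ ih => exact ih.symm
    | trans _ _ _ _ _ ih₁ ih₂ => exact ih₁.trans ih₂
  have right : Optic.mk (diamondRep k' h) = Optic.mk (diamondRep k' h') := by
    clear left
    induction hh with
    | rel _ _ r => exact Quot.sound (r.diamondRep_right k')
    | refl _ => rfl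
    | symm _ _ _ ih => exact ih.symm
    | trans _ _ _ _ _ ih₁ ih₂ => exact ih₁.trans ih₂
  exact left.trans right
end

section
/- Let A be a type and C a monoid (Mathlib's Monoid C). The multiplication ⊛ on the escrow set ⟨⟨A,C⟩⟩ sending h = ⟦M, h₁, h₂⟧ and k = ⟦N, k₁, k₂⟧ to h ⊛ k := ⟦M × N, fun a => let (m, x) := h₁ a; let (n, y) := k₁ a; ((m, n), x * y), fun q => h₂ (q.1.1, q.2) * k₂ (q.1.2, q.2)⟧ is well-defined: replacing either representative by a ∼-equivalent one yields the same equivalence class. -/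
/-- The convolution-style multiplication `⊛` on representatives of `⟨⟨A,C⟩⟩`,
for `A` a (diagonal) comonoid and `C` a monoid. -/
def mulRep {A C : Type} [Monoid C] (h k : EscrowRep A C) : EscrowRep A C :=
  ⟨h.1 × k.1,
   fun a => (((h.2.1 a).1, (k.2.1 a).1), (h.2.1 a).2 * (k.2.1 a).2),
   fun q => h.2.2 (q.1.1, q.2) * k.2.2 (q.1.2, q.2)⟩

theorem Optic.mk_eq_mk_of_opticSim {A B S T A' B' S' T' : Type}
    (F : OpticRep A B S T → OpticRep A' B' S' T')
    (hF : ∀ x y, OpticRel A B S T x y → Optic.mk (F x) = Optic.mk (F y))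
    {x y : OpticRep A B S T} (hxy : opticSim x y) : Optic.mk (F x) = Optic.mk (F y) := by
  induction hxy with
  | rel x y h => exact hF x y h
  | refl x => rfl
  | symm x y _ ih => exact ih.symm
  | trans x y z _ _ ih₁ ih₂ => exact ih₁.trans ih₂

theorem OpticRel.mulRep_left {A C : Type} [Monoid C] {h h' : EscrowRep A C}
    (hh : OpticRel C A A C h h') (k : EscrowRep A C) :
    OpticRel C A A C (mulRep h k) (mulRep h' k) := by
  obtain ⟨f, u, v⟩ := hh
  exact .slide (Prod.map f id) (fun a => (((u a).1, (k.2.1 a).1), (u a).2 * (k.2.1 a).2))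
    (fun q => v (q.1.1, q.2) * k.2.2 (q.1.2, q.2))

theorem OpticRel.mulRep_right {A C : Type} [Monoid C] (h : EscrowRep A C) {k k' : EscrowRep A C}
    (hk : OpticRel C A A C k k') :
    OpticRel C A A C (mulRep h k) (mulRep h k') := by
  obtain ⟨f, u, v⟩ := hk
  exact .slide (Prod.map id f) (fun a => (((h.2.1 a).1, (u a).1), (h.2.1 a).2 * (u a).2))
    (fun q => h.2.2 (q.1.1, q.2) * v (q.1.2, q.2))

/-- the multiplication `⊛` on `⟨⟨A,C⟩⟩` is well defined on `∼`-classes. -/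
theorem statement7 (A C : Type) [Monoid C]
    (h h' k k' : EscrowRep A C) (hh : opticSim h h') (hk : opticSim k k') :
    Optic.mk (mulRep h k) = Optic.mk (mulRep h' k') := by
  exact (Optic.mk_eq_mk_of_opticSim (mulRep · k)
      (fun _ _ hxy => Quot.sound (hxy.mulRep_left k)) hh).trans
    (Optic.mk_eq_mk_of_opticSim (mulRep h')
      (fun _ _ hxy => Quot.sound (hxy.mulRep_right h')) hk)
end

section
/- Let A be a type and C a monoid (Mathlib's Monoid C). The element i := ⟦Unit, fun _ => ((), (1 : C)), fun _ => (1 : C)⟧ ∈ ⟨⟨A,C⟩⟩ is a two-sided unit for the multiplication ⊛ on ⟨⟨A,C⟩⟩: h ⊛ i = h and i ⊛ h = h for every h ∈ ⟨⟨A,C⟩⟩, where ⊛ sends ⟦M, h₁, h₂⟧ and ⟦N, k₁, k₂⟧ to ⟦M × N, fun a => let (m, x) := h₁ a; let (n, y) := k₁ a; ((m, n), x * y), fun q => h₂ (q.1.1, q.2) * k₂ (q.1.2, q.2)⟧. (Together with associativity, this makes the set of escrows ⟨⟨A,C⟩⟩ a monoid.) -/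
/-- The unit escrow `i = ⟦Unit, fun _ => ((), 1), fun _ => 1⟧ ∈ ⟨⟨A,C⟩⟩`. -/
def unitRep (A C : Type) [Monoid C] : EscrowRep A C :=
  ⟨Unit, fun _ => ((), (1 : C)), fun _ => (1 : C)⟩

/-- Sliding a map between residuals does not change the optic, stated up to equality of legs. -/
theorem Optic.mk_eq_of_slide {A B S T M N : Type} (f : M → N) {u : S → M × A} {v : M × B → T}
    {w : S → N × A} {z : N × B → T} (hu : ∀ s, w s = (f (u s).1, (u s).2))
    (hv : ∀ p, v p = z (f p.1, p.2)) :
    Optic.mk (⟨M, u, v⟩ : OpticRep A B S T) = Optic.mk ⟨N, w, z⟩ := by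
  obtain rfl := funext hu
  obtain rfl := funext hv
  exact Quot.sound (OpticRel.slide f u z)

/-- the escrow `i` is a two-sided unit for `⊛` on `⟨⟨A,C⟩⟩`. -/
theorem statement9 (A C : Type) [Monoid C] (h : EscrowRep A C) :
    Optic.mk (mulRep h (unitRep A C)) = Optic.mk h ∧
    Optic.mk (mulRep (unitRep A C) h) = Optic.mk h := by
  obtain ⟨M, u, v⟩ := h
  exact ⟨Optic.mk_eq_of_slide Prod.fst (fun a => by simp [unitRep]) (fun p => by simp [unitRep]),
    Optic.mk_eq_of_slide Prod.snd (fun a => by simp [unitRep]) (fun p => by simp [unitRep])⟩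
end

section
/- Let A be a type, C a monoid, B a type with a multiplicative action of C on B (Mathlib's MulAction C B, written •), and γ : B → A a function (the A-coaction on B). The operation ⋊ sending an escrow h = ⟦M, h₁, h₂⟧ ∈ ⟨⟨A,C⟩⟩ and an optic o = ⟦P, o₁, o₂⟧ ∈ Optic B B A C (so o₁ : A → P × B and o₂ : P × B → C) to h ⋊ o := ⟦M × P, fun a => let (m, x) := h₁ a; let (p, b) := o₁ a; ((m, p), x • b), fun q => h₂ (q.1.1, γ q.2) * o₂ (q.1.2, q.2)⟧ ∈ Optic B B A C is well-defined: replacing either representative by a ∼-equivalent one yields the same equivalence class. -/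
/-- The action `⋊` of an escrow in `⟨⟨A,C⟩⟩` on an optic in `Optic B B A C`, on
representatives; `B` is a `C`-module via `•` and an `A`-comodule via `γ : B → A`. -/
def actRep {A B C : Type} [Monoid C] [MulAction C B] (γ : B → A)
    (h : EscrowRep A C) (o : OpticRep B B A C) : OpticRep B B A C :=
  ⟨h.1 × o.1,
   fun a => (((h.2.1 a).1, (o.2.1 a).1), (h.2.1 a).2 • (o.2.1 a).2),
   fun q => h.2.2 (q.1.1, γ q.2) * o.2.2 (q.1.2, q.2)⟩

theorem opticRel_actRep_left {A B C : Type} [Monoid C] [MulAction C B] (γ : B → A)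
    {h h' : EscrowRep A C} (o : OpticRep B B A C) (hh : OpticRel C A A C h h') :
    OpticRel B B A C (actRep γ h o) (actRep γ h' o) := by
  obtain ⟨f, u, v⟩ := hh
  exact .slide (Prod.map f id)
    (fun a => (((u a).1, (o.2.1 a).1), (u a).2 • (o.2.1 a).2))
    (fun q => v (q.1.1, γ q.2) * o.2.2 (q.1.2, q.2))

theorem opticRel_actRep_right {A B C : Type} [Monoid C] [MulAction C B] (γ : B → A)
    (h : EscrowRep A C) {o o' : OpticRep B B A C} (ho : OpticRel B B A C o o') :
    OpticRel B B A C (actRep γ h o) (actRep γ h o') := by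
  obtain ⟨f, u, v⟩ := ho
  exact .slide (Prod.map id f)
    (fun a => (((h.2.1 a).1, (u a).1), (h.2.1 a).2 • (u a).2))
    (fun q => h.2.2 (q.1.1, γ q.2) * v (q.1.2, q.2))

/-- the operation `⋊` is well defined on `∼`-classes. -/
theorem statement10 (A B C : Type) [Monoid C] [MulAction C B] (γ : B → A)
    (h h' : EscrowRep A C) (o o' : OpticRep B B A C)
    (hh : opticSim h h') (ho : opticSim o o') :
    Optic.mk (actRep γ h o) = Optic.mk (actRep γ h' o') := by
  have left : Optic.mk (actRep γ h o) = Optic.mk (actRep γ h' o) :=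
    congrArg (Quot.lift (fun k => Optic.mk (actRep γ k o))
      fun _ _ r => Quot.sound (opticRel_actRep_left γ o r)) (Quot.eqvGen_sound hh)
  have right : Optic.mk (actRep γ h' o) = Optic.mk (actRep γ h' o') :=
    congrArg (Quot.lift (fun k => Optic.mk (actRep γ h' k))
      fun _ _ r => Quot.sound (opticRel_actRep_right γ h' r)) (Quot.eqvGen_sound ho)
  exact left.trans right
end

section
/- Let A be a type, C a monoid, B a type with a MulAction of C on B (written •), and γ : B → A. The unit escrow i := ⟦Unit, fun _ => ((), (1 : C)), fun _ => (1 : C)⟧ ∈ ⟨⟨A,C⟩⟩ acts trivially: for every optic o ∈ Optic B B A C one has i ⋊ o = o, where ⋊ sends ⟦M, h₁, h₂⟧ ∈ ⟨⟨A,C⟩⟩ and ⟦P, o₁, o₂⟧ ∈ Optic B B A C to ⟦M × P, fun a => let (m, x) := h₁ a; let (p, b) := o₁ a; ((m, p), x • b), fun q => h₂ (q.1.1, γ q.2) * o₂ (q.1.2, q.2)⟧. -/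
/-- the unit escrow acts trivially via `⋊`. -/
theorem statement11 (A B C : Type) [Monoid C] [MulAction C B] (γ : B → A)
    (o : OpticRep B B A C) :
    Optic.mk (actRep γ (unitRep A C) o) = Optic.mk o := by
  obtain ⟨P, o₁, o₂⟩ := o
  have h := Quot.sound (OpticRel.slide (Prod.snd : Unit × P → P)
    (fun a => (((), (o₁ a).1), (o₁ a).2)) o₂)
  simp only [Optic.mk, actRep, unitRep, one_smul, one_mul]
  exact h
end

section
/- Let A be a type, C a monoid, B a type with a MulAction of C on B (written •), and γ : B → A. The operation ⋊ satisfies the action axiom with respect to the escrow multiplication ⊛: for all escrows h, k ∈ ⟨⟨A,C⟩⟩ and every optic o ∈ Optic B B A C, (k ⊛ h) ⋊ o = k ⋊ (h ⋊ o). Here ⊛ sends ⟦M, h₁, h₂⟧, ⟦N, k₁, k₂⟧ ∈ ⟨⟨A,C⟩⟩ to ⟦M × N, fun a => let (m, x) := h₁ a; let (n, y) := k₁ a; ((m, n), x * y), fun q => h₂ (q.1.1, q.2) * k₂ (q.1.2, q.2)⟧, and ⋊ sends ⟦M, h₁, h₂⟧ ∈ ⟨⟨A,C⟩⟩ and ⟦P,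 o₁, o₂⟧ ∈ Optic B B A C to ⟦M × P, fun a => let (m, x) := h₁ a; let (p, b) := o₁ a; ((m, p), x • b), fun q => h₂ (q.1.1, γ q.2) * o₂ (q.1.2, q.2)⟧. (Together with unitality this makes ⋊ an action of the escrow monoid ⟨⟨A,C⟩⟩ on the set Optic B B A C.) -/
/-- Two optic representatives are identified as soon as a map of residuals is compatible
with both legs. -/
theorem Optic.mk_eq_of_map {A B S T M N : Type} {u : S → M × A} {v : M × B → T}
    {u' : S → N × A} {v' : N × B → T} (f : M → N)
    (hu : ∀ s, u' s = (f (u s).1, (u s).2)) (hv : ∀ m b, v (m, b) = v' (f m, b)) :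
    Optic.mk ⟨M, u, v⟩ = Optic.mk ⟨N, u', v'⟩ := by
  obtain rfl : u' = fun s => (f (u s).1, (u s).2) := funext hu
  obtain rfl : v = fun p => v' (f p.1, p.2) := funext fun p => hv p.1 p.2
  exact Quot.sound (OpticRel.slide f u v')

/-- `⋊` satisfies the action axiom over the escrow multiplication `⊛`. -/
theorem statement12 (A B C : Type) [Monoid C] [MulAction C B] (γ : B → A)
    (h k : EscrowRep A C) (o : OpticRep B B A C) :
    Optic.mk (actRep γ (mulRep k h) o) = Optic.mk (actRep γ k (actRep γ h o)) := by
  refine Optic.mk_eq_of_map (Equiv.prodAssoc k.1 h.1 o.1) (fun a => ?_) (fun m b => ?_)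
  · exact Prod.ext rfl (mul_smul _ _ _).symm
  · exact mul_assoc _ _ _
end
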